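/- Let F be a point-shift such that for μ-almost every ω the functional graph G^F(ω) contains no directed cycle. Then the Palm expectation of the total number of descendants of the origin is infinite: E_{μ_0}[d(0)] = ∞, where d(0) := #{y ∈ ω : F_ω^n(y) = 0 for some n ≥ 1}. -/

import Mathlib

open Function Set MeasureTheory ProbabilityTheory
open scoped ENNReal NNReal

namespace PointShift

/-- Points of the grid `ℤ^d`. -/
abbrev Pt (d : ℕ) := Fin d → ℤ

/-- Configurations: subsets of the grid `ℤ^d`, identified with `{0,1}`-valued
functions, equipped with the product σ-algebra. -/
abbrev Conf (d : ℕ) := Pt d → Bool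

/-- The shift `θ_t ω = ω - t`. -/
def shift {d : ℕ} (t : Pt d) (ω : Conf d) : Conf d := fun x => ω (x + t)

/-- The support of a configuration, as a subset of `ℤ^d`. -/
def pts {d : ℕ} (ω : Conf d) : Set (Pt d) := {x | ω x = true}

/-- `g` is a point-map: it is measurable and selects a point of every
configuration having a point at the origin. -/
def IsPointMap {d : ℕ} (g : Conf d → Pt d) : Prop :=
  Measurable g ∧ ∀ ω : Conf d, ω 0 = true → ω (g ω) = true

/-- The point-shift associated with a point-map `g`: `F_ω x = x + g (θ_x ω)`. -/
def Fps {d : ℕ} (g : Conf d → Pt d) (ω : Conf d) (x : Pt d) : Pt d :=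
  x + g (shift x ω)

/-- `μ` is a stationary point process on the grid: a shift-invariant probability
measure with a point at the origin with positive probability. -/
def IsStationaryPP {d : ℕ} (μ : Measure (Conf d)) : Prop :=
  IsProbabilityMeasure μ ∧ (∀ t : Pt d, μ.map (shift t) = μ) ∧
    0 < μ {ω : Conf d | ω 0 = true}

/-- The Palm probability of `μ`: `μ` conditioned on having a point at the origin. -/
noncomputable def Palm {d : ℕ} (μ : Measure (Conf d)) : Measure (Conf d) :=
  μ[|{ω : Conf d | ω 0 = true}]

/-- The foil of the point `x` in the configuration `ω`, for the point-shift of `g`. -/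
def foilOn {d : ℕ} (g : Conf d → Pt d) (ω : Conf d) (x : Pt d) : Set (Pt d) :=
  {y | ω y = true ∧ ∃ n : ℕ, (Fps g ω)^[n] y = (Fps g ω)^[n] x}

/-- The connected component of the point `x` in the functional graph `G^F(ω)`. -/
def compOn {d : ℕ} (g : Conf d → Pt d) (ω : Conf d) (x : Pt d) : Set (Pt d) :=
  {y | ω y = true ∧ ∃ m n : ℕ, (Fps g ω)^[m] x = (Fps g ω)^[n] y}

/-- `K` is a directed cycle of the functional graph of `f`: a finite set of
distinct points `c 0, …, c (k-1)` (with `k ≥ 1`) such that `f (c i) = c ((i+1) % k)`. -/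
def IsCycle {X : Type*} (f : X → X) (K : Set X) : Prop :=
  ∃ (k : ℕ) (c : ℕ → X), 0 < k ∧
    (∀ i < k, ∀ j < k, c i = c j → i = j) ∧
    (∀ i < k, f (c i) = c ((i + 1) % k)) ∧
    K = c '' {i | i < k}

end PointShift

namespace PointShift

variable {d : ℕ}

lemma measurable_shift (t : Pt d) : Measurable (shift t : Conf d → Conf d) :=
  measurable_pi_lambda _ fun x => measurable_pi_apply (x + t)

lemma measurable_Fps_iterate {g : Conf d → Pt d} (hg : Measurable g) (n : ℕ) (x : Pt d) :
    Measurable fun ω => (Fps g ω)^[n] x := by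
  induction n generalizing x with
  | zero => exact measurable_const
  | succ n ih =>
    have h1 : Measurable fun p : Conf d × Pt d => Fps g p.1 p.2 :=
      measurable_from_prod_countable_left fun y =>
        measurable_const.add (hg.comp (measurable_shift y))
    simp only [iterate_succ_apply']
    exact h1.comp (measurable_id.prodMk (ih x))

/-- Equivariance of point-shifts. -/
lemma Fps_shift (g : Conf d → Pt d) (t : Pt d) (ω : Conf d) (x : Pt d) :
    Fps g (shift t ω) x = Fps g ω (x + t) - t := by
  have h : shift x (shift t ω) = shift (x + t) ω := by
    funext z
    simp only [shift, add_assoc]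
  simp only [Fps, h]
  abel

lemma Fps_shift_iterate (g : Conf d → Pt d) (t : Pt d) (ω : Conf d) (n : ℕ) (x : Pt d) :
    (Fps g (shift t ω))^[n] x = (Fps g ω)^[n] (x + t) - t := by
  induction n with
  | zero => simp
  | succ n ih => rw [iterate_succ_apply', iterate_succ_apply', ih, Fps_shift, sub_add_cancel]

lemma Fps_iterate_mem {g : Conf d → Pt d} (hg : IsPointMap g) {ω : Conf d} {x : Pt d}
    (hx : ω x = true) (n : ℕ) : ω ((Fps g ω)^[n] x) = true := by
  induction n with
  | zero => exact hx
  | succ n ih =>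
    rw [iterate_succ_apply']
    have h := hg.2 (shift ((Fps g ω)^[n] x) ω) (by simpa [shift] using ih)
    simpa [shift, Fps, add_comm] using h

/-- The orbit of a periodic point is a directed cycle. -/
lemma isCycle_of_mem_periodicPts {X : Type*} {f : X → X} {x : X} (hx : x ∈ periodicPts f) :
    IsCycle f ((fun i => f^[i] x) '' {i | i < minimalPeriod f x}) := by
  refine ⟨minimalPeriod f x, fun i => f^[i] x, minimalPeriod_pos_of_mem_periodicPts hx,
    fun i hi j hj h => iterate_injOn_Iio_minimalPeriod hi hj h, fun i _ => ?_, rfl⟩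
  simp only [iterate_mod_minimalPeriod_eq, iterate_succ_apply']

/-- In an acyclic functional graph, every point reaches the origin in at most one way. -/
lemma eq_of_iterate_eq_of_acyclic {g : Conf d → Pt d} (hg : IsPointMap g) {ω : Conf d}
    (h : ¬ ∃ K : Set (Pt d), IsCycle (Fps g ω) K ∧ K ⊆ pts ω) {x y : Pt d} (hy : ω y = true)
    {m n : ℕ} (hm : (Fps g ω)^[m] y = x) (hn : (Fps g ω)^[n] y = x) : m = n := by
  wlog hmn : m < n generalizing m n
  · rcases (not_lt.mp hmn).eq_or_lt with e | e
    · exact e.symm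
    · exact (this hn hm e).symm
  refine (h ⟨_, isCycle_of_mem_periodicPts (x := x) ?_, ?_⟩).elim
  · refine mk_mem_periodicPts (Nat.sub_pos_of_lt hmn) ?_
    rw [IsPeriodicPt, IsFixedPt]
    nth_rw 1 [← hm]
    rw [← iterate_add_apply, Nat.sub_add_cancel hmn.le, hn]
  · rintro _ ⟨i, _, rfl⟩
    exact Fps_iterate_mem hg (hm ▸ Fps_iterate_mem hg hy m) i

/-- Configurations in which `y` is a point whose `n`-th image is the origin. -/
def descendantEvent (g : Conf d → Pt d) (n : ℕ) (y : Pt d) : Set (Conf d) :=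
  {ω | ω y = true ∧ (Fps g ω)^[n] y = 0}

lemma measurableSet_eq_true (y : Pt d) : MeasurableSet {ω : Conf d | ω y = true} :=
  (measurable_pi_apply (X := fun _ : Pt d => Bool) y) (measurableSet_singleton true)

lemma measurableSet_descendantEvent {g : Conf d → Pt d} (hg : Measurable g) (n : ℕ) (y : Pt d) :
    MeasurableSet (descendantEvent g n y) :=
  (measurableSet_eq_true y).inter
    (measurable_Fps_iterate hg n y (measurableSet_singleton 0))

/-- Mass transport: the mean number of descendants of order `n` of the origin. -/
lemma tsum_measure_descendantEvent {μ : Measure (Conf d)}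
    (hinv : ∀ t : Pt d, μ.map (shift t) = μ) {g : Conf d → Pt d} (hg : Measurable g) (n : ℕ) :
    ∑' y, μ (descendantEvent g n y) = μ {ω : Conf d | ω 0 = true} := by
  let C : Pt d → Set (Conf d) := fun z => {ω | ω 0 = true} ∩ {ω | (Fps g ω)^[n] 0 = z}
  have hC : ∀ z, MeasurableSet (C z) := fun z =>
    (measurableSet_eq_true 0).inter (measurable_Fps_iterate hg n 0 (measurableSet_singleton z))
  have h1 : ∀ y, μ (descendantEvent g n y) = μ (C (-y)) := by
    intro y
    conv_rhs => rw [← hinv y, Measure.map_apply (measurable_shift y) (hC _)]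
    congr 1
    ext ω
    simp [C, descendantEvent, Fps_shift_iterate, shift, sub_eq_iff_eq_add]
  simp only [h1]
  refine ((Equiv.neg (Pt d)).tsum_eq fun z => μ (C z)).trans ?_
  rw [← measure_iUnion _ hC]
  · congr 1
    ext ω
    simp [C]
  · intro z w hzw
    refine Set.disjoint_left.mpr fun ω hz hw => hzw ?_
    exact hz.2.symm.trans hw.2

lemma tsum_indicator_descendantEvent_le {g : Conf d → Pt d} (hg : IsPointMap g) {ω : Conf d}
    (h : ¬ ∃ K : Set (Pt d), IsCycle (Fps g ω) K ∧ K ⊆ pts ω) :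
    ∑' n : ℕ, ∑' y, (descendantEvent g (n + 1) y).indicator (1 : Conf d → ℝ≥0∞) ω ≤
      ({y : Pt d | ω y = true ∧ ∃ n : ℕ, 1 ≤ n ∧ (Fps g ω)^[n] y = 0}.encard : ℝ≥0∞) := by
  rw [ENNReal.tsum_comm, ← ENNReal.tsum_set_one, tsum_subtype _ fun _ => (1 : ℝ≥0∞)]
  refine ENNReal.tsum_le_tsum fun y => ?_
  by_cases hy : ∃ n : ℕ, ω ∈ descendantEvent g (n + 1) y
  · obtain ⟨n, hn⟩ := hy
    rw [tsum_eq_single n, Set.indicator_of_mem hn, Set.indicator_of_mem]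
    · rfl
    · exact ⟨hn.1, n + 1, by omega, hn.2⟩
    · intro m hm
      refine Set.indicator_of_notMem (fun hm' => hm ?_) _
      exact Nat.succ_injective (eq_of_iterate_eq_of_acyclic hg h hn.1 hm'.2 hn.2)
  · push Not at hy
    simp [Set.indicator_of_notMem (hy _)]

lemma descendantEvent_subset {g : Conf d → Pt d} (hg : IsPointMap g) (n : ℕ) (y : Pt d) :
    descendantEvent g n y ⊆ {ω | ω 0 = true} := fun ω hω => by
  have h := Fps_iterate_mem hg hω.1 n
  rwa [hω.2] at h

end PointShift

/-- If the functional graph `G^F(ω)` is `μ`-almost surely acyclic,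
then the Palm expectation of the total number of descendants of the origin is infinite. -/
theorem stmt_8 {d : ℕ} (hd : 0 < d)
    (μ : Measure (PointShift.Conf d)) [IsProbabilityMeasure μ]
    (hinv : ∀ t : PointShift.Pt d, μ.map (PointShift.shift t) = μ)
    (hpos : 0 < μ {ω : PointShift.Conf d | ω 0 = true})
    (g : PointShift.Conf d → PointShift.Pt d) (hg : PointShift.IsPointMap g)
    (hacyc : ∀ᵐ ω ∂μ, ¬ ∃ K : Set (PointShift.Pt d),
      PointShift.IsCycle (PointShift.Fps g ω) K ∧ K ⊆ PointShift.pts ω) :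
    ∫⁻ ω, ({y : PointShift.Pt d |
        ω y = true ∧ ∃ n : ℕ, 1 ≤ n ∧ (PointShift.Fps g ω)^[n] y = 0}.encard : ℝ≥0∞)
      ∂(PointShift.Palm μ) = ⊤ := by
  have hA := PointShift.measurableSet_eq_true (0 : PointShift.Pt d)
  have key : ∫⁻ ω in {ω : PointShift.Conf d | ω 0 = true}, ({y : PointShift.Pt d |
      ω y = true ∧ ∃ n : ℕ, 1 ≤ n ∧ (PointShift.Fps g ω)^[n] y = 0}.encard : ℝ≥0∞) ∂μ = ⊤ := by
    refine top_le_iff.mp ?_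
    have hm := fun n y => PointShift.measurableSet_descendantEvent hg.1 n y
    have hi := fun n y => (measurable_one (α := ℝ≥0∞)).indicator (hm n y)
    calc (⊤ : ℝ≥0∞) = ∑' _ : ℕ, μ {ω : PointShift.Conf d | ω 0 = true} :=
          (ENNReal.tsum_const_eq_top_of_ne_zero hpos.ne').symm
      _ = ∑' n : ℕ, ∑' y, μ (PointShift.descendantEvent g (n + 1) y) := by
          simp only [PointShift.tsum_measure_descendantEvent hinv hg.1]
      _ = ∫⁻ ω in {ω : PointShift.Conf d | ω 0 = true}, ∑' n : ℕ, ∑' y,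
            (PointShift.descendantEvent g (n + 1) y).indicator (1 : PointShift.Conf d → ℝ≥0∞) ω ∂μ := by
          rw [lintegral_tsum fun n =>
            (Measurable.tsum fun y => hi (n + 1) y).aemeasurable]
          refine tsum_congr fun n => ?_
          rw [lintegral_tsum fun y => (hi (n + 1) y).aemeasurable]
          refine tsum_congr fun y => ?_
          rw [lintegral_indicator_one (hm _ _), Measure.restrict_apply (hm _ _),
            Set.inter_eq_left.mpr (PointShift.descendantEvent_subset hg _ _)]
      _ ≤ _ := lintegral_mono_ae <| (ae_restrict_of_ae hacyc).mono fun ω h =>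
          PointShift.tsum_indicator_descendantEvent_le hg h
  rw [PointShift.Palm, ProbabilityTheory.cond, lintegral_smul_measure, key, smul_eq_mul,
    ENNReal.mul_top (ENNReal.inv_ne_zero.mpr (measure_ne_top μ _))]
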